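/- arXiv:1006.1010 — 8 statements merged into one kernel-verified Lean document; each statement's English description precedes it below -/
import Mathlib

section
/- Let C be a monoidal category, (X, ∇, ⊥) a monoid object and (X, Δ, ⊤) a comonoid object on the same underlying object X. Set η = Δ ∘ ⊥ : I → X ⊗ X. Then the Lawvere condition, (id_X ⊗ ∇) ∘ α⁻¹ ∘ (η ⊗ id_X) ∘ λ⁻¹ = Δ = (∇ ⊗ id_X) ∘ α ∘ (id_X ⊗ η) ∘ ρ⁻¹, holds if and only if the Frobenius condition, (id_X ⊗ ∇) ∘ α ∘ (Δ ⊗ id_X) = Δ ∘ ∇ = (∇ ⊗ id_X) ∘ α⁻¹ ∘ (id_X ⊗ Δ), holds. No commutativity assumptions are needed. -/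
open CategoryTheory MonoidalCategory

section

variable {C : Type*} [Category C] [MonoidalCategory C] {X : C} {mul : X ⊗ X ⟶ X}

/-- Copying by left multiplication into a fixed element of `X ⊗ X` is right linear. -/
theorem frobenius_left_of_lawvere_left
    (h_assoc : (mul ▷ X) ≫ mul = (α_ X X X).hom ≫ (X ◁ mul) ≫ mul)
    {e : 𝟙_ C ⟶ X ⊗ X} {d : X ⟶ X ⊗ X}
    (h : (λ_ X).inv ≫ (e ▷ X) ≫ (α_ X X X).hom ≫ (X ◁ mul) = d) :
    (d ▷ X) ≫ (α_ X X X).hom ≫ (X ◁ mul) = mul ≫ d := by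
  subst h
  calc
    _ = (λ_ X).inv ▷ X ≫ e ▷ X ▷ X ≫ (α_ X X X).hom ▷ X ≫ (α_ X (X ⊗ X) X).hom ≫
          X ◁ (mul ▷ X ≫ mul) := by simp
    _ = (λ_ (X ⊗ X)).inv ≫ e ▷ (X ⊗ X) ≫ (X ⊗ X) ◁ mul ≫ (α_ X X X).hom ≫ X ◁ mul := by
      rw [h_assoc]; simp
    _ = _ := by
      rw [← whisker_exchange_assoc, leftUnitor_inv_naturality_assoc]

/-- Copying by right multiplication into a fixed element of `X ⊗ X` is left linear. -/
theorem frobenius_right_of_lawvere_right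
    (h_assoc : (mul ▷ X) ≫ mul = (α_ X X X).hom ≫ (X ◁ mul) ≫ mul)
    {e : 𝟙_ C ⟶ X ⊗ X} {d : X ⟶ X ⊗ X}
    (h : (ρ_ X).inv ≫ (X ◁ e) ≫ (α_ X X X).inv ≫ (mul ▷ X) = d) :
    (X ◁ d) ≫ (α_ X X X).inv ≫ (mul ▷ X) = mul ≫ d := by
  have h_assoc' : X ◁ mul ≫ mul = (α_ X X X).inv ≫ mul ▷ X ≫ mul := by simp [h_assoc]
  subst h
  calc
    _ = X ◁ (ρ_ X).inv ≫ X ◁ X ◁ e ≫ X ◁ (α_ X X X).inv ≫ (α_ X (X ⊗ X) X).inv ≫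
          (X ◁ mul ≫ mul) ▷ X := by simp
    _ = (ρ_ (X ⊗ X)).inv ≫ (X ⊗ X) ◁ e ≫ mul ▷ (X ⊗ X) ≫ (α_ X X X).inv ≫ mul ▷ X := by
      rw [h_assoc']; simp
    _ = _ := by
      rw [whisker_exchange_assoc, rightUnitor_inv_naturality_assoc]

end

/-- **Statement 6.** For a monoid object `(X, ∇, ⊥)` and a comonoid object `(X, Δ, ⊤)` on the
same object `X` of a monoidal category, with `η = Δ ∘ ⊥`, the Lawvere condition
`(id ⊗ ∇) ∘ α ∘ (η ⊗ id) ∘ λ⁻¹ = Δ = (∇ ⊗ id) ∘ α⁻¹ ∘ (id ⊗ η) ∘ ρ⁻¹`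
holds if and only if the Frobenius condition
`(id ⊗ ∇) ∘ α ∘ (Δ ⊗ id) = Δ ∘ ∇ = (∇ ⊗ id) ∘ α⁻¹ ∘ (id ⊗ Δ)` holds.
No commutativity assumptions are needed. -/
theorem lawvere_iff_frobenius
    {C : Type*} [Category C] [MonoidalCategory C]
    (X : C) (mul : X ⊗ X ⟶ X) (bot : 𝟙_ C ⟶ X)
    (delta : X ⟶ X ⊗ X) (top : X ⟶ 𝟙_ C)
    (h_assoc : (mul ▷ X) ≫ mul = (α_ X X X).hom ≫ (X ◁ mul) ≫ mul)
    (h_one_mul : (bot ▷ X) ≫ mul = (λ_ X).hom)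
    (h_mul_one : (X ◁ bot) ≫ mul = (ρ_ X).hom)
    (h_coassoc : delta ≫ (delta ▷ X) ≫ (α_ X X X).hom = delta ≫ (X ◁ delta))
    (h_counit_l : delta ≫ (top ▷ X) ≫ (λ_ X).hom = 𝟙 X)
    (h_counit_r : delta ≫ (X ◁ top) ≫ (ρ_ X).hom = 𝟙 X) :
    -- Lawvere condition
    (((λ_ X).inv ≫ ((bot ≫ delta) ▷ X) ≫ (α_ X X X).hom ≫ (X ◁ mul) = delta) ∧
     ((ρ_ X).inv ≫ (X ◁ (bot ≫ delta)) ≫ (α_ X X X).inv ≫ (mul ▷ X) = delta)) ↔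
    -- Frobenius condition
    (((delta ▷ X) ≫ (α_ X X X).hom ≫ (X ◁ mul) = mul ≫ delta) ∧
     ((X ◁ delta) ≫ (α_ X X X).inv ≫ (mul ▷ X) = mul ≫ delta)) := by
  constructor
  · rintro ⟨hl, hr⟩
    exact ⟨frobenius_left_of_lawvere_left h_assoc hl,
      frobenius_right_of_lawvere_right h_assoc hr⟩
  · rintro ⟨hl, hr⟩
    constructor
    · rw [comp_whiskerRight_assoc, hl, reassoc_of% h_one_mul, Iso.inv_hom_id_assoc]
    · rw [whiskerLeft_comp_assoc, hr, reassoc_of% h_mul_one, Iso.inv_hom_id_assoc]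
end

section
/- The monoid part of a classical structure determines its comonoid part: let C be a symmetric monoidal category, (X, ∇, ⊥) a commutative monoid object, and suppose (Δ₁, ⊤₁) and (Δ₂, ⊤₂) are two comonoid structures on X such that both (X, ∇, ⊥, Δ₁, ⊤₁) and (X, ∇, ⊥, Δ₂, ⊤₂) are commutative special Frobenius algebras. Then Δ₁ = Δ₂ and ⊤₁ = ⊤₂. -/
open CategoryTheory MonoidalCategory

section

variable {C : Type*} [Category C] [MonoidalCategory C]

/-- A left counit and a right counit of the same comultiplication agree. -/
theorem counit_eq_of_left_right {X : C} {delta : X ⟶ X ⊗ X} {top₁ top₂ : X ⟶ 𝟙_ C}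
    (h_left : delta ≫ (top₁ ▷ X) ≫ (λ_ X).hom = 𝟙 X)
    (h_right : delta ≫ (X ◁ top₂) ≫ (ρ_ X).hom = 𝟙 X) : top₁ = top₂ := by
  calc top₁ = (delta ≫ (X ◁ top₂) ≫ (ρ_ X).hom) ≫ top₁ := by rw [h_right, Category.id_comp]
    _ = delta ≫ (X ◁ top₂) ≫ (top₁ ▷ 𝟙_ C) ≫ (ρ_ (𝟙_ C)).hom := by simp
    _ = delta ≫ (top₁ ▷ X) ≫ (𝟙_ C ◁ top₂) ≫ (λ_ (𝟙_ C)).hom := by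
      rw [whisker_exchange_assoc, unitors_equal]
    _ = (delta ≫ (top₁ ▷ X) ≫ (λ_ X).hom) ≫ top₂ := by simp
    _ = top₂ := by rw [h_left, Category.id_comp]

variable [SymmetricCategory C]

/-- For a commutative multiplication, the Frobenius law allows multiplying the first output of the
comultiplication of the left input by the right input. -/
theorem frobenius_mul_comul_left {X : C} {mul : X ⊗ X ⟶ X} {delta : X ⟶ X ⊗ X}
    (h_comm : (β_ X X).hom ≫ mul = mul)
    (h_frob : (X ◁ delta) ≫ (α_ X X X).inv ≫ (mul ▷ X) = mul ≫ delta) :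
    (delta ▷ X) ≫ (α_ X X X).hom ≫ (X ◁ (β_ X X).hom) ≫ (α_ X X X).inv ≫ (mul ▷ X) =
      mul ≫ delta := by
  symm
  calc mul ≫ delta = (β_ X X).hom ≫ mul ≫ delta := by rw [reassoc_of% h_comm]
    _ = (delta ▷ X) ≫ (β_ (X ⊗ X) X).hom ≫ (α_ X X X).inv ≫ (mul ▷ X) := by
      rw [← h_frob, BraidedCategory.braiding_naturality_left_assoc]
    _ = (delta ▷ X) ≫ (α_ X X X).hom ≫ (X ◁ (β_ X X).hom) ≫ (α_ X X X).inv ≫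
        (((β_ X X).hom ≫ mul) ▷ X) := by
      simp [BraidedCategory.braiding_tensor_left_hom]
    _ = _ := by rw [h_comm]

/-- For a commutative multiplication, the Frobenius law allows multiplying the second output of the
comultiplication of the right input by the left input. -/
theorem frobenius_mul_comul_right {X : C} {mul : X ⊗ X ⟶ X} {delta : X ⟶ X ⊗ X}
    (h_comm : (β_ X X).hom ≫ mul = mul)
    (h_frob : (delta ▷ X) ≫ (α_ X X X).hom ≫ (X ◁ mul) = mul ≫ delta) :
    (X ◁ delta) ≫ (α_ X X X).inv ≫ ((β_ X X).hom ▷ X) ≫ (α_ X X X).hom ≫ (X ◁ mul) =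
      mul ≫ delta := by
  symm
  calc mul ≫ delta = (β_ X X).hom ≫ mul ≫ delta := by rw [reassoc_of% h_comm]
    _ = (X ◁ delta) ≫ (β_ X (X ⊗ X)).hom ≫ (α_ X X X).hom ≫ (X ◁ mul) := by
      rw [← h_frob, BraidedCategory.braiding_naturality_right_assoc]
    _ = (X ◁ delta) ≫ (α_ X X X).inv ≫ ((β_ X X).hom ▷ X) ≫ (α_ X X X).hom ≫
        (X ◁ ((β_ X X).hom ≫ mul)) := by
      simp [BraidedCategory.braiding_tensor_right_hom]
    _ = _ := by rw [h_comm]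

/-- For two Frobenius comultiplications over the same commutative multiplication, the
endomorphisms `mul ≫ delta₁` and `mul ≫ delta₂` of `X ⊗ X` commute. -/
theorem frobenius_mul_comul_commute {X : C} {mul : X ⊗ X ⟶ X} {delta₁ delta₂ : X ⟶ X ⊗ X}
    (h_comm : (β_ X X).hom ≫ mul = mul)
    (h_frob₁ : (delta₁ ▷ X) ≫ (α_ X X X).hom ≫ (X ◁ mul) = mul ≫ delta₁ ∧
      (X ◁ delta₁) ≫ (α_ X X X).inv ≫ (mul ▷ X) = mul ≫ delta₁)
    (h_frob₂ : (delta₂ ▷ X) ≫ (α_ X X X).hom ≫ (X ◁ mul) = mul ≫ delta₂ ∧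
      (X ◁ delta₂) ≫ (α_ X X X).inv ≫ (mul ▷ X) = mul ≫ delta₂) :
    (mul ≫ delta₁) ≫ mul ≫ delta₂ = (mul ≫ delta₂) ≫ mul ≫ delta₁ := by
  have h₁ : (mul ≫ delta₁) ≫ mul ≫ delta₂ =
      (delta₂ ⊗ₘ delta₁) ≫ tensorμ X X X X ≫ (mul ⊗ₘ mul) := by
    calc (mul ≫ delta₁) ≫ mul ≫ delta₂
      _ = (X ◁ delta₁) ≫ (α_ X X X).inv ≫ ((mul ≫ delta₂) ▷ X) ≫ (α_ X X X).hom ≫ (X ◁ mul) := by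
        rw [comp_whiskerRight_assoc, h_frob₂.1, reassoc_of% h_frob₁.2, Category.assoc]
      _ = _ := by
        rw [← frobenius_mul_comul_left h_comm h_frob₂.2, MonoidalCategory.tensorHom_def' delta₂,
          MonoidalCategory.tensorHom_def mul]
        simp [tensorμ]
  have h₂ : (mul ≫ delta₂) ≫ mul ≫ delta₁ =
      (delta₂ ⊗ₘ delta₁) ≫ tensorμ X X X X ≫ (mul ⊗ₘ mul) := by
    calc (mul ≫ delta₂) ≫ mul ≫ delta₁
      _ = (delta₂ ▷ X) ≫ (α_ X X X).hom ≫ (X ◁ (mul ≫ delta₁)) ≫ (α_ X X X).inv ≫ (mul ▷ X) := by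
        rw [whiskerLeft_comp_assoc, h_frob₁.2, reassoc_of% h_frob₂.1, Category.assoc]
      _ = _ := by
        rw [← frobenius_mul_comul_right h_comm h_frob₁.1, MonoidalCategory.tensorHom_def delta₂,
          MonoidalCategory.tensorHom_def' mul]
        simp [tensorμ]
  rw [h₁, h₂]

end

/-- **Statement 8.** The monoid part of a classical structure determines its comonoid part:
if `(X, ∇, ⊥)` is a commutative monoid object of a symmetric monoidal category and
`(Δ₁, ⊤₁)`, `(Δ₂, ⊤₂)` are two comonoid structures on `X` such that both
`(X, ∇, ⊥, Δ₁, ⊤₁)` and `(X, ∇, ⊥, Δ₂, ⊤₂)` are commutative special Frobenius algebras,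
then `Δ₁ = Δ₂` and `⊤₁ = ⊤₂`. -/
theorem classical_structure_comonoid_unique
    {C : Type*} [Category C] [MonoidalCategory C] [SymmetricCategory C]
    (X : C) (mul : X ⊗ X ⟶ X) (bot : 𝟙_ C ⟶ X)
    (delta₁ delta₂ : X ⟶ X ⊗ X) (top₁ top₂ : X ⟶ 𝟙_ C)
    -- commutative monoid
    (h_assoc : (mul ▷ X) ≫ mul = (α_ X X X).hom ≫ (X ◁ mul) ≫ mul)
    (h_one_mul : (bot ▷ X) ≫ mul = (λ_ X).hom)
    (h_mul_one : (X ◁ bot) ≫ mul = (ρ_ X).hom)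
    (h_comm : (β_ X X).hom ≫ mul = mul)
    -- first cocommutative comonoid, Frobenius and special
    (h_coassoc₁ : delta₁ ≫ (delta₁ ▷ X) ≫ (α_ X X X).hom = delta₁ ≫ (X ◁ delta₁))
    (h_counit_l₁ : delta₁ ≫ (top₁ ▷ X) ≫ (λ_ X).hom = 𝟙 X)
    (h_counit_r₁ : delta₁ ≫ (X ◁ top₁) ≫ (ρ_ X).hom = 𝟙 X)
    (h_cocomm₁ : delta₁ ≫ (β_ X X).hom = delta₁)
    (h_frob₁ : (delta₁ ▷ X) ≫ (α_ X X X).hom ≫ (X ◁ mul) = mul ≫ delta₁ ∧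
      (X ◁ delta₁) ≫ (α_ X X X).inv ≫ (mul ▷ X) = mul ≫ delta₁)
    (h_special₁ : delta₁ ≫ mul = 𝟙 X)
    -- second cocommutative comonoid, Frobenius and special
    (h_coassoc₂ : delta₂ ≫ (delta₂ ▷ X) ≫ (α_ X X X).hom = delta₂ ≫ (X ◁ delta₂))
    (h_counit_l₂ : delta₂ ≫ (top₂ ▷ X) ≫ (λ_ X).hom = 𝟙 X)
    (h_counit_r₂ : delta₂ ≫ (X ◁ top₂) ≫ (ρ_ X).hom = 𝟙 X)
    (h_cocomm₂ : delta₂ ≫ (β_ X X).hom = delta₂)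
    (h_frob₂ : (delta₂ ▷ X) ≫ (α_ X X X).hom ≫ (X ◁ mul) = mul ≫ delta₂ ∧
      (X ◁ delta₂) ≫ (α_ X X X).inv ≫ (mul ▷ X) = mul ≫ delta₂)
    (h_special₂ : delta₂ ≫ mul = 𝟙 X) :
    delta₁ = delta₂ ∧ top₁ = top₂ := by
  have h_delta : delta₁ = delta₂ := by
    have h := delta₁ ≫= frobenius_mul_comul_commute h_comm h_frob₁ h_frob₂
    simpa only [Category.assoc, reassoc_of% h_special₁, reassoc_of% h_special₂] using h.symm
  subst h_delta
  exact ⟨rfl, counit_eq_of_left_right h_counit_l₁ h_counit_r₂⟩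
end

section
/- Let (X, ∇, ⊥, Δ, ⊤) be a commutative Frobenius algebra (monoid commutative and comonoid cocommutative) in a symmetric monoidal category C, and let b : I → X and c : X → I be arbitrary morphisms. Define L = ∇ ∘ (b ⊗ id_X) ∘ λ_X⁻¹ : X → X and R = ρ_X ∘ (id_X ⊗ c) ∘ Δ : X → X. Then L ∘ R = M = R ∘ L, where M = ρ_X ∘ (id_X ⊗ (c ∘ ∇)) ∘ α ∘ ((Δ ∘ b) ⊗ id_X) ∘ λ_X⁻¹ : X → X is the morphism obtained by tensoring the input on the left with Δ ∘ b : I → X ⊗ X and then contracting the last two factors with c ∘ ∇ : X ⊗ X → I. In particular, L ∘ R = id_X holds if and only if M = id_X, if and only if R ∘ L = id_X. -/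
open CategoryTheory MonoidalCategory

/-- **Statement 10.** Let `(X, ∇, ⊥, Δ, ⊤)` be a commutative Frobenius algebra in a
symmetric monoidal category and `b : I ⟶ X`, `c : X ⟶ I` arbitrary morphisms. With
`L = ∇ ∘ (b ⊗ id) ∘ λ⁻¹`, `R = ρ ∘ (id ⊗ c) ∘ Δ`, and `M` the morphism `X ⟶ X` obtained by
tensoring on the left with `Δ ∘ b : I ⟶ X ⊗ X` and contracting the last two factors with
`c ∘ ∇ : X ⊗ X ⟶ I`, we have `L ∘ R = M = R ∘ L`. In particular `L ∘ R = id` iff `M = id`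
iff `R ∘ L = id`. -/
theorem frobenius_left_right_sandwich
    {C : Type*} [Category C] [MonoidalCategory C] [SymmetricCategory C]
    (X : C) (mul : X ⊗ X ⟶ X) (bot : 𝟙_ C ⟶ X)
    (delta : X ⟶ X ⊗ X) (top : X ⟶ 𝟙_ C)
    -- commutative monoid
    (h_assoc : (mul ▷ X) ≫ mul = (α_ X X X).hom ≫ (X ◁ mul) ≫ mul)
    (h_one_mul : (bot ▷ X) ≫ mul = (λ_ X).hom)
    (h_mul_one : (X ◁ bot) ≫ mul = (ρ_ X).hom)
    (h_comm : (β_ X X).hom ≫ mul = mul)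
    -- cocommutative comonoid
    (h_coassoc : delta ≫ (delta ▷ X) ≫ (α_ X X X).hom = delta ≫ (X ◁ delta))
    (h_counit_l : delta ≫ (top ▷ X) ≫ (λ_ X).hom = 𝟙 X)
    (h_counit_r : delta ≫ (X ◁ top) ≫ (ρ_ X).hom = 𝟙 X)
    (h_cocomm : delta ≫ (β_ X X).hom = delta)
    -- Frobenius condition
    (h_frob : (delta ▷ X) ≫ (α_ X X X).hom ≫ (X ◁ mul) = mul ≫ delta ∧
      (X ◁ delta) ≫ (α_ X X X).inv ≫ (mul ▷ X) = mul ≫ delta)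
    (b : 𝟙_ C ⟶ X) (c : X ⟶ 𝟙_ C)
    -- L, R and M
    (L R M : X ⟶ X)
    (hL : L = (λ_ X).inv ≫ (b ▷ X) ≫ mul)
    (hR : R = delta ≫ (X ◁ c) ≫ (ρ_ X).hom)
    (hM : M = (λ_ X).inv ≫ ((b ≫ delta) ▷ X) ≫ (α_ X X X).hom ≫ (X ◁ (mul ≫ c)) ≫
      (ρ_ X).hom) :
    (R ≫ L = M ∧ L ≫ R = M) ∧
    ((R ≫ L = 𝟙 X ↔ M = 𝟙 X) ∧ (M = 𝟙 X ↔ L ≫ R = 𝟙 X)) := by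
  have h_factor : M = (λ_ X).inv ≫ (b ▷ X) ≫ mul ≫ delta ≫ (X ◁ c) ≫ (ρ_ X).hom := by
    rw [hM, ← reassoc_of% h_frob.1]
    simp
  have h_RL : R ≫ L = M := by
    have h_slide : (X ◁ delta) ≫ (α_ X X X).inv ≫ (mul ▷ X) ≫ (X ◁ c) ≫ (ρ_ X).hom =
        (X ◁ (delta ≫ (X ◁ c) ≫ (ρ_ X).hom)) ≫ mul := by
      rw [← whisker_exchange_assoc]
      simp
    rw [h_factor, ← reassoc_of% h_frob.2, h_slide, ← hR, ← whisker_exchange_assoc, hL]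
    simp
  have h_LR : L ≫ R = M := by
    rw [h_factor, hL, hR]
    simp
  exact ⟨⟨h_RL, h_LR⟩, by rw [h_RL], by rw [h_LR]⟩
end

section
/- Every disjoint union of abelian groups is a classical structure in the category of relations: let (G_j)_{j ∈ J} be a family of abelian groups and X = Σ_{j ∈ J} G_j their disjoint union (elements written (j, g) with g ∈ G_j). Define relations ∇ : X × X → X by ((j, g), (j', g')) ∇ (j'', g'') iff j = j' = j'' and g'' = g + g', and ⊥ : 1 → X relating the point of 1 to each (j, 0_j); let Δ = ∇° and ⊤ = ⊥° be their converses. Then (X, ∇, ⊥) is a commutative monoid and (X, Δ, ⊤) a cocommutative comonoid in the monoidal category (Rel, ×, 1), the Frobenius condition (id_X × ∇) ∘ (Δ × id_X) = Δ ∘ ∇ = (∇ × id_X) ∘ (id_X × Δ) holds, and the structure is special: ∇ ∘ Δ = id_X. -/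
/-! Concrete presentation of the symmetric monoidal category `Rel` of sets and relations:
relations `A → B → Prop`, relational composition, product of relations, identity relation,
converse, and the coherence bijections (as relations). -/

/-- Relational composition. -/
def rcomp {α β γ : Type*} (R : α → β → Prop) (S : β → γ → Prop) : α → γ → Prop :=
  fun a c => ∃ b, R a b ∧ S b c

/-- Product of relations (the tensor of `Rel`). -/
def rprod {α β γ δ : Type*} (R : α → β → Prop) (S : γ → δ → Prop) :
    α × γ → β × δ → Prop :=
  fun p q => R p.1 q.1 ∧ S p.2 q.2

/-- Identity relation (the diagonal). -/
def rid (α : Type*) : α → α → Prop := fun a b => a = b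

/-- Converse of a relation. -/
def rconv {α β : Type*} (R : α → β → Prop) : β → α → Prop := fun b a => R a b

/-- The associator coherence bijection, as a relation. -/
def rassoc (α β γ : Type*) : (α × β) × γ → α × (β × γ) → Prop :=
  fun p q => q = (p.1.1, (p.1.2, p.2))

/-- The symmetry, as a relation. -/
def rswap (α β : Type*) : α × β → β × α → Prop := fun p q => q = (p.2, p.1)

/-- The left unitor coherence bijection, as a relation. -/
def rlunit (α : Type*) : Unit × α → α → Prop := fun p a => a = p.2

/-- The right unitor coherence bijection, as a relation. -/
def rrunit (α : Type*) : α × Unit → α → Prop := fun p a => a = p.1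

/-- **Statement 12.** Every disjoint union of abelian groups is a classical structure in
`Rel`: for `X = Σ j, G j`, the relations `∇` (blockwise addition) and `⊥` (the set of
units), together with their converses `Δ` and `⊤`, form a commutative monoid and a
cocommutative comonoid satisfying the Frobenius condition, and the structure is special. -/
theorem disjoint_union_of_abelian_groups_is_classical_structure
    {J : Type*} (G : J → Type*) [∀ j, AddCommGroup (G j)]
    (nabla : (Σ j, G j) × (Σ j, G j) → (Σ j, G j) → Prop)
    (bot : Unit → (Σ j, G j) → Prop)
    (h_nabla : nabla = fun p x => ∃ (j : J) (g h : G j),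
      p = (⟨j, g⟩, ⟨j, h⟩) ∧ x = ⟨j, g + h⟩)
    (h_bot : bot = fun _ x => ∃ j : J, x = ⟨j, (0 : G j)⟩) :
    letI X := Σ j, G j
    letI delta := rconv nabla
    letI top := rconv bot
    -- associativity of the monoid
    (rcomp (rprod nabla (rid X)) nabla =
      rcomp (rassoc X X X) (rcomp (rprod (rid X) nabla) nabla)) ∧
    -- unit laws of the monoid
    (rcomp (rprod bot (rid X)) nabla = rlunit X) ∧
    (rcomp (rprod (rid X) bot) nabla = rrunit X) ∧
    -- commutativity of the monoid
    (rcomp (rswap X X) nabla = nabla) ∧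
    -- coassociativity of the comonoid
    (rcomp (rcomp delta (rprod delta (rid X))) (rassoc X X X) =
      rcomp delta (rprod (rid X) delta)) ∧
    -- counit laws of the comonoid
    (rcomp (rcomp delta (rprod top (rid X))) (rlunit X) = rid X) ∧
    (rcomp (rcomp delta (rprod (rid X) top)) (rrunit X) = rid X) ∧
    -- cocommutativity of the comonoid
    (rcomp delta (rswap X X) = delta) ∧
    -- the Frobenius condition
    (rcomp (rprod delta (rid X)) (rcomp (rassoc X X X) (rprod (rid X) nabla)) =
      rcomp nabla delta) ∧
    (rcomp (rprod (rid X) delta) (rcomp (rconv (rassoc X X X)) (rprod nabla (rid X))) =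
      rcomp nabla delta) ∧
    -- specialness
    (rcomp delta nabla = rid X) := by
  subst h_nabla h_bot
  refine ⟨?_, ?_, ?_, ?_, ?_, ?_, ?_, ?_, ?_, ?_, ?_⟩ <;> ext p q <;>
    simp only [rcomp, rprod, rid, rconv, rassoc, rswap, rlunit, rrunit]
  · obtain ⟨⟨x, y⟩, z⟩ := p
    constructor
    · rintro ⟨⟨_, _⟩, ⟨⟨j, a, b, ⟨⟩, ⟨⟩⟩, ⟨⟩⟩, _, _, c, ⟨⟩, ⟨⟩⟩
      exact ⟨_, rfl, (⟨j, a⟩, ⟨j, b + c⟩), ⟨rfl, j, b, c, rfl, rfl⟩, j, a, b + c, rfl, by rw [add_assoc]⟩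
    · rintro ⟨_, ⟨⟩, ⟨_, _⟩, ⟨⟨⟩, j, b, c, ⟨⟩, ⟨⟩⟩, _, a, _, ⟨⟩, ⟨⟩⟩
      exact ⟨(⟨j, a + b⟩, ⟨j, c⟩), ⟨⟨j, a, b, rfl, rfl⟩, rfl⟩, j, a + b, c, rfl, by rw [add_assoc]⟩
  · obtain ⟨_, j, g⟩ := p
    constructor
    · rintro ⟨⟨_, _⟩, ⟨⟨_, ⟨⟩⟩, ⟨⟩⟩, _, _, _, ⟨⟩, ⟨⟩⟩
      simp
    · rintro rfl
      exact ⟨(⟨j, 0⟩, ⟨j, g⟩), ⟨⟨j, rfl⟩, rfl⟩, j, 0, g, rfl, by simp⟩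
  · obtain ⟨⟨j, g⟩, _⟩ := p
    constructor
    · rintro ⟨⟨_, _⟩, ⟨⟨⟩, ⟨_, ⟨⟩⟩⟩, _, _, _, ⟨⟩, ⟨⟩⟩
      simp
    · rintro rfl
      exact ⟨(⟨j, g⟩, ⟨j, 0⟩), ⟨rfl, ⟨j, rfl⟩⟩, j, g, 0, rfl, by simp⟩
  · obtain ⟨x, y⟩ := p
    constructor
    · rintro ⟨_, ⟨⟩, j, a, b, ⟨⟩, ⟨⟩⟩
      exact ⟨j, b, a, rfl, by rw [add_comm]⟩
    · rintro ⟨j, a, b, ⟨⟩, ⟨⟩⟩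
      exact ⟨_, rfl, j, b, a, rfl, by rw [add_comm]⟩
  · obtain ⟨x, y, z⟩ := q
    constructor
    · rintro ⟨⟨⟨_, _⟩, _⟩, ⟨⟨_, _⟩, ⟨j, _, c, ⟨⟩, ⟨⟩⟩, ⟨_, a, b, ⟨⟩, ⟨⟩⟩, ⟨⟩⟩, ⟨⟩⟩
      exact ⟨(⟨j, a⟩, ⟨j, b + c⟩), ⟨j, a, b + c, rfl, by rw [add_assoc]⟩, rfl, j, b, c, rfl, rfl⟩
    · rintro ⟨⟨_, _⟩, ⟨j, a, _, ⟨⟩, ⟨⟩⟩, ⟨⟩, _, b, c, ⟨⟩, ⟨⟩⟩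
      exact ⟨((⟨j, a⟩, ⟨j, b⟩), ⟨j, c⟩), ⟨(⟨j, a + b⟩, ⟨j, c⟩),
        ⟨j, a + b, c, rfl, by rw [add_assoc]⟩, ⟨j, a, b, rfl, rfl⟩, rfl⟩, rfl⟩
  · constructor
    · rintro ⟨⟨_, _⟩, ⟨⟨_, _⟩, ⟨j, _, b, ⟨⟩, ⟨⟩⟩, ⟨_, ⟨⟩⟩, ⟨⟩⟩, ⟨⟩⟩
      simp
    · rintro rfl
      obtain ⟨j, g⟩ := p
      exact ⟨((), ⟨j, g⟩), ⟨(⟨j, 0⟩, ⟨j, g⟩), ⟨j, 0, g, rfl, by simp⟩, ⟨j, rfl⟩, rfl⟩, rfl⟩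
  · constructor
    · rintro ⟨⟨_, _⟩, ⟨⟨_, _⟩, ⟨j, b, _, ⟨⟩, ⟨⟩⟩, ⟨⟩, ⟨_, ⟨⟩⟩⟩, ⟨⟩⟩
      simp
    · rintro rfl
      obtain ⟨j, g⟩ := p
      exact ⟨(⟨j, g⟩, ()), ⟨(⟨j, g⟩, ⟨j, 0⟩), ⟨j, g, 0, rfl, by simp⟩, rfl, ⟨j, rfl⟩⟩, rfl⟩
  · constructor
    · rintro ⟨_, ⟨j, a, b, ⟨⟩, ⟨⟩⟩, ⟨⟩⟩
      exact ⟨j, b, a, rfl, by rw [add_comm]⟩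
    · rintro ⟨j, a, b, ⟨⟩, ⟨⟩⟩
      exact ⟨(⟨j, b⟩, ⟨j, a⟩), ⟨j, b, a, rfl, by rw [add_comm]⟩, rfl⟩
  · obtain ⟨x, y⟩ := p
    obtain ⟨u, v⟩ := q
    constructor
    · rintro ⟨⟨⟨_, _⟩, _⟩, ⟨⟨j, a, b, ⟨⟩, ⟨⟩⟩, ⟨⟩⟩, _, ⟨⟩, ⟨⟩, _, _, c, ⟨⟩, ⟨⟩⟩
      exact ⟨_, ⟨j, a + b, c, rfl, rfl⟩, j, a, b + c, rfl, by rw [add_assoc]⟩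
    · rintro ⟨_, ⟨j, g, h, ⟨⟩, ⟨⟩⟩, _, a, b, ⟨⟩, e⟩
      obtain ⟨rfl, e⟩ := Sigma.mk.inj_iff.mp e
      have e := eq_of_heq e
      exact ⟨((⟨j, a⟩, ⟨j, g - a⟩), ⟨j, h⟩), ⟨⟨j, a, g - a, rfl, by simp⟩, rfl⟩, _, rfl, rfl,
        j, g - a, h, rfl, by rw [sub_add_eq_add_sub, e, add_sub_cancel_left]⟩
  · obtain ⟨x, y⟩ := p
    obtain ⟨u, v⟩ := q
    constructor
    · rintro ⟨⟨_, _, _⟩, ⟨⟨⟩, j, b, c, ⟨⟩, ⟨⟩⟩, ⟨⟨_, _⟩, _⟩, ⟨⟩, ⟨_, a, _, ⟨⟩, ⟨⟩⟩, ⟨⟩⟩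
      exact ⟨_, ⟨j, a, b + c, rfl, rfl⟩, j, a + b, c, rfl, by rw [add_assoc]⟩
    · rintro ⟨_, ⟨j, g, h, ⟨⟩, ⟨⟩⟩, _, a, b, ⟨⟩, e⟩
      obtain ⟨rfl, e⟩ := Sigma.mk.inj_iff.mp e
      have e := eq_of_heq e
      exact ⟨(⟨j, g⟩, (⟨j, h - b⟩, ⟨j, b⟩)), ⟨rfl, j, h - b, b, rfl, by simp⟩,
        ((⟨j, g⟩, ⟨j, h - b⟩), ⟨j, b⟩), rfl,
        ⟨j, g, h - b, rfl, by rw [← add_sub_assoc, e, add_sub_cancel_right]⟩, rfl⟩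
  · constructor
    · rintro ⟨_, ⟨j, a, b, ⟨⟩, ⟨⟩⟩, _, _, _, ⟨⟩, ⟨⟩⟩
      rfl
    · rintro rfl
      obtain ⟨j, g⟩ := p
      exact ⟨(⟨j, g⟩, ⟨j, 0⟩), ⟨j, g, 0, rfl, by simp⟩, j, g, 0, rfl, by simp⟩
end

section
/- Every classical structure in the category of relations is a disjoint union of abelian groups: let X be a set and Δ ⊆ X × (X × X), ⊤ ⊆ X × 1 relations making (X, Δ, ⊤) a cocommutative comonoid in (Rel, ×, 1), such that with ∇ = Δ° and ⊥ = ⊤° the Frobenius condition (id_X × ∇) ∘ (Δ × id_X) = Δ ∘ ∇ = (∇ × id_X) ∘ (id_X × Δ) and specialness ∇ ∘ Δ = id_X hold. Then there exist a partition X = ⋃_{j ∈ J} X_j into nonempty pairwise disjoint blocks and an abelian group structure (+_j, 0_j) on each block X_j such that (x, (y, z)) ∈ Δ if and only if x, y, z lie in a common block X_j and x = y +_j z, and (x, *) ∈ ⊤ if and only if x = 0_j for some j. -/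
/-- The elementwise laws of a special commutative Frobenius structure on `X` in `Rel`, where
`m x y z` reads as `x = y + z` for a partial addition with set of units `T`. -/
structure IsPartialSum {X : Type*} (m : X → X → X → Prop) (T : X → Prop) : Prop where
  comm : ∀ {x y z}, m x y z → m x z y
  assoc : ∀ {x a b c}, (∃ w, m x w c ∧ m w a b) ↔ ∃ w, m x a w ∧ m w b c
  unit_exists : ∀ x, ∃ e, T e ∧ m x e x
  unit_eq : ∀ {e x y}, T e → m x e y → x = y
  frob : ∀ {x y p q}, (∃ b, m x p b ∧ m q b y) ↔ ∃ w, m w x y ∧ m w p q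
  unique : ∀ {x x' y z}, m x y z → m x' y z → x = x'

namespace IsPartialSum

variable {X : Type*} {m : X → X → X → Prop} {T : X → Prop} (h : IsPartialSum m T)
include h

theorem unit_unique {e e' x : X} (he : T e) (he' : T e') (hx : m x e x) (hx' : m x e' x) :
    e = e' := by
  obtain ⟨w, -, hw⟩ := h.assoc.2 ⟨x, hx, hx'⟩
  exact (h.unit_eq he' (h.comm hw)).symm.trans (h.unit_eq he hw)

theorem exists_unitOf : ∃ e : X → {x // T x}, ∀ x, m x (e x) x := by
  choose e he hm using h.unit_exists
  exact ⟨fun x => ⟨e x, he x⟩, hm⟩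

theorem unit_add_self {e : X} (he : T e) : m e e e := by
  obtain ⟨e', he', hm⟩ := h.unit_exists e
  obtain rfl := h.unit_eq he (h.comm hm)
  exact hm

theorem unit_left {e x y z : X} (hx : m x y z) (hy : m y e y) : m x e x := by
  obtain ⟨w, hw, hw'⟩ := h.assoc.1 ⟨y, hx, hy⟩
  obtain rfl := h.unique hw' hx
  exact hw

theorem exists_sum {e y z : X} (hy : m y e y) (hz : m z e z) : ∃ x, m x y z := by
  obtain ⟨w, hw, -⟩ := h.frob.1 ⟨e, h.comm hy, hz⟩
  exact ⟨w, hw⟩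

theorem exists_neg {e a : X} (ha : m a e a) : ∃ b, m e b a := by
  obtain ⟨b, -, hb⟩ := h.frob.2 ⟨a, ha, h.comm ha⟩
  exact ⟨b, hb⟩

section Fibers

variable {e : X → {x // T x}} (he : ∀ x, m x (e x) x)
include he

theorem unitOf_eq {j : {x // T x}} {x : X} (hx : m x j x) : e x = j :=
  Subtype.ext (h.unit_unique (e x).2 j.2 (he x) hx)

theorem unitOf_left {x y z : X} (hx : m x y z) : e x = e y :=
  h.unitOf_eq he (h.unit_left hx (he y))

theorem unitOf_right {x y z : X} (hx : m x y z) : e x = e z :=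
  h.unitOf_left he (h.comm hx)

theorem exists_fiber_sum (j : {x // T x}) (a b : {x // e x = j}) :
    ∃ c : {x // e x = j}, m c a b := by
  obtain ⟨a, rfl⟩ := a
  obtain ⟨b, hb⟩ := b
  obtain ⟨c, hc⟩ := h.exists_sum (he a) (hb ▸ he b)
  exact ⟨⟨c, h.unitOf_left he hc⟩, hc⟩

theorem exists_fiber_neg (j : {x // T x}) (a : {x // e x = j}) :
    ∃ b : {x // e x = j}, m j b a := by
  obtain ⟨a, rfl⟩ := a
  obtain ⟨b, hb⟩ := h.exists_neg (he a)
  exact ⟨⟨b, (h.unitOf_left he hb).symm.trans (h.unitOf_right he hb)⟩, hb⟩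

end Fibers

end IsPartialSum

theorem isPartialSum_of_classical_structure {X : Type*}
    {delta : X → X × X → Prop} {top : X → Unit → Prop}
    (h_coassoc : rcomp (rcomp delta (rprod delta (rid X))) (rassoc X X X) =
      rcomp delta (rprod (rid X) delta))
    (h_counit_l : rcomp (rcomp delta (rprod top (rid X))) (rlunit X) = rid X)
    (h_cocomm : rcomp delta (rswap X X) = delta)
    (h_frob_l : rcomp (rprod delta (rid X)) (rcomp (rassoc X X X) (rprod (rid X)
      (rconv delta))) = rcomp (rconv delta) delta)
    (h_special : rcomp delta (rconv delta) = rid X) :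
    IsPartialSum (fun x y z => delta x (y, z)) (fun x => top x ()) where
  comm {x y z} hx := by
    rw [← h_cocomm]
    exact ⟨_, hx, rfl⟩
  assoc {x a b c} := by
    simpa [rcomp, rprod, rid, rassoc] using congrFun (congrFun h_coassoc x) (a, (b, c))
  unit_exists x := by
    have key := congrFun (congrFun h_counit_l x) x
    obtain ⟨⟨_, _⟩, ⟨⟨e, _⟩, hx, he, rfl⟩, rfl⟩ := key.mpr rfl
    exact ⟨e, he, hx⟩
  unit_eq {e x y} he hx := by
    have key := congrFun (congrFun h_counit_l x) y
    exact key.mp ⟨((), y), ⟨(e, y), hx, he, rfl⟩, rfl⟩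
  frob {x y p q} := by
    have key := congrFun (congrFun h_frob_l (x, y)) (p, q)
    simpa [rcomp, rprod, rid, rassoc, rconv] using key
  unique {x x' y z} hx hx' := by
    have key := congrFun (congrFun h_special x) x'
    exact key.mp ⟨_, hx, hx'⟩

/-- **Statement 13.** Every classical structure in `Rel` is a disjoint union of abelian
groups: if `(X, Δ, ⊤)` is a cocommutative comonoid in `Rel` such that, with `∇ = Δ°` and
`⊥ = ⊤°`, the Frobenius condition and specialness hold, then `X` decomposes as a disjoint
union of abelian groups in such a way that `Δ` is blockwise addition (in converse) and `⊤`
is the set of group units. -/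
theorem classical_structure_in_Rel_is_disjoint_union_of_abelian_groups
    {X : Type u}
    (delta : X → X × X → Prop) (top : X → Unit → Prop)
    -- coassociativity
    (h_coassoc : rcomp (rcomp delta (rprod delta (rid X))) (rassoc X X X) =
      rcomp delta (rprod (rid X) delta))
    -- counit laws
    (h_counit_l : rcomp (rcomp delta (rprod top (rid X))) (rlunit X) = rid X)
    (h_counit_r : rcomp (rcomp delta (rprod (rid X) top)) (rrunit X) = rid X)
    -- cocommutativity
    (h_cocomm : rcomp delta (rswap X X) = delta)
    -- the Frobenius condition for ∇ = Δ°
    (h_frob_l : rcomp (rprod delta (rid X)) (rcomp (rassoc X X X) (rprod (rid X)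
      (rconv delta))) = rcomp (rconv delta) delta)
    (h_frob_r : rcomp (rprod (rid X) delta) (rcomp (rconv (rassoc X X X)) (rprod
      (rconv delta) (rid X))) = rcomp (rconv delta) delta)
    -- specialness
    (h_special : rcomp delta (rconv delta) = rid X) :
    ∃ (J : Type u) (G : J → Type u)
      (add : ∀ j, G j → G j → G j) (zero : ∀ j, G j) (neg : ∀ j, G j → G j)
      (φ : X ≃ Σ j, G j),
      -- each block is an abelian group
      (∀ j (a b : G j), add j a b = add j b a) ∧
      (∀ j (a b c : G j), add j (add j a b) c = add j a (add j b c)) ∧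
      (∀ j (a : G j), add j (zero j) a = a) ∧
      (∀ j (a : G j), add j (neg j a) a = zero j) ∧
      -- Δ is blockwise addition
      (∀ x y z : X, delta x (y, z) ↔ ∃ (j : J) (a b : G j),
        φ y = ⟨j, a⟩ ∧ φ z = ⟨j, b⟩ ∧ φ x = ⟨j, add j a b⟩) ∧
      -- ⊤ is the set of group units
      (∀ (x : X) (u : Unit), top x u ↔ ∃ j : J, φ x = ⟨j, zero j⟩) := by
  have h := isPartialSum_of_classical_structure h_coassoc h_counit_l h_cocomm h_frob_l h_special
  obtain ⟨e, he⟩ := h.exists_unitOf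
  choose add hadd using h.exists_fiber_sum he
  choose neg hneg using h.exists_fiber_neg he
  have add_eq {j} {a b c : {x // e x = j}} (hc : delta c (a, b)) : add j a b = c :=
    Subtype.ext (h.unique (hadd j a b) hc)
  have e_self (j : {x // top x ()}) : e j = j := h.unitOf_eq he (h.unit_add_self j.2)
  have φ_eq {x : X} {j} {a : {x // e x = j}} :
      (Equiv.sigmaFiberEquiv e).symm x = ⟨j, a⟩ ↔ x = a := by
    rw [Equiv.symm_apply_eq]; rfl
  refine ⟨{x // top x ()}, fun j => {x // e x = j}, add, fun j => ⟨j, e_self j⟩, neg,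
    (Equiv.sigmaFiberEquiv e).symm, ?_, ?_, ?_, ?_, ?_, ?_⟩
  · exact fun j a b => add_eq (h.comm (hadd j b a))
  · intro j a b c
    obtain ⟨w, hw, hw'⟩ := h.assoc.1 ⟨_, hadd j (add j a b) c, hadd j a b⟩
    obtain rfl := h.unique (hadd j b c) hw'
    exact (add_eq hw).symm
  · rintro j ⟨a, rfl⟩
    exact add_eq (he a)
  · exact fun j a => add_eq (hneg j a)
  · intro x y z
    simp only [φ_eq]
    constructor
    · intro hx
      have hy := h.unitOf_left he hx
      have hz := h.unitOf_right he hx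
      exact ⟨e x, ⟨y, hy.symm⟩, ⟨z, hz.symm⟩, rfl, rfl,
        congrArg Subtype.val (add_eq (c := ⟨x, rfl⟩) hx).symm⟩
    · rintro ⟨j, a, b, rfl, rfl, rfl⟩
      exact hadd j a b
  · intro x u
    simp only [φ_eq]
    exact ⟨fun hx => ⟨⟨x, hx⟩, rfl⟩, fun ⟨j, hj⟩ => hj ▸ j.2⟩
end

section
/- Let (X, ∇, ⊥, Δ, ⊤) be a commutative special Frobenius algebra in a symmetric monoidal category C, and let α : X ⊗ A → A be a normal X-action, i.e. α ∘ (id_X ⊗ α) = α ∘ (∇ ⊗ id_A) (modulo the associator) and α ∘ (⊥ ⊗ id_A) ∘ λ_A⁻¹ = id_A. Suppose β : A → X ⊗ A is a morphism satisfying (id_X ⊗ α) ∘ α_assoc ∘ (Δ ⊗ id_A) = β ∘ α = (∇ ⊗ id_A) ∘ α_assoc⁻¹ ∘ (id_X ⊗ β) (as morphisms X ⊗ A → X ⊗ A, associators inserted as indicated). Then α ∘ β = id_A. -/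
open CategoryTheory MonoidalCategory

/-- **Statement 15.** Let `(X, ∇, ⊥, Δ, ⊤)` be a commutative special Frobenius algebra in
a symmetric monoidal category and `α : X ⊗ A ⟶ A` a normal `X`-action. If `β : A ⟶ X ⊗ A`
satisfies `(id_X ⊗ α) ∘ assoc ∘ (Δ ⊗ id_A) = β ∘ α = (∇ ⊗ id_A) ∘ assoc⁻¹ ∘ (id_X ⊗ β)`,
then `α ∘ β = id_A`. -/
theorem normal_action_retraction
    {C : Type*} [Category C] [MonoidalCategory C] [SymmetricCategory C]
    (X : C) (mul : X ⊗ X ⟶ X) (bot : 𝟙_ C ⟶ X)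
    (delta : X ⟶ X ⊗ X) (top : X ⟶ 𝟙_ C)
    -- commutative monoid
    (h_assoc : (mul ▷ X) ≫ mul = (α_ X X X).hom ≫ (X ◁ mul) ≫ mul)
    (h_one_mul : (bot ▷ X) ≫ mul = (λ_ X).hom)
    (h_mul_one : (X ◁ bot) ≫ mul = (ρ_ X).hom)
    (h_comm : (β_ X X).hom ≫ mul = mul)
    -- cocommutative comonoid
    (h_coassoc : delta ≫ (delta ▷ X) ≫ (α_ X X X).hom = delta ≫ (X ◁ delta))
    (h_counit_l : delta ≫ (top ▷ X) ≫ (λ_ X).hom = 𝟙 X)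
    (h_counit_r : delta ≫ (X ◁ top) ≫ (ρ_ X).hom = 𝟙 X)
    (h_cocomm : delta ≫ (β_ X X).hom = delta)
    -- Frobenius and special
    (h_frob : (delta ▷ X) ≫ (α_ X X X).hom ≫ (X ◁ mul) = mul ≫ delta ∧
      (X ◁ delta) ≫ (α_ X X X).inv ≫ (mul ▷ X) = mul ≫ delta)
    (h_special : delta ≫ mul = 𝟙 X)
    (A : C) (a : X ⊗ A ⟶ A) (b : A ⟶ X ⊗ A)
    -- `a` is an `X`-action ...
    (h_action : (α_ X X A).hom ≫ (X ◁ a) ≫ a = (mul ▷ A) ≫ a)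
    -- ... which is normal
    (h_normal : (λ_ A).inv ≫ (bot ▷ A) ≫ a = 𝟙 A)
    -- the sandwich equalities for `b`
    (h_sandwich_l : (delta ▷ A) ≫ (α_ X X A).hom ≫ (X ◁ a) = a ≫ b)
    (h_sandwich_r : a ≫ b = (X ◁ b) ≫ (α_ X X A).inv ≫ (mul ▷ A)) :
    b ≫ a = 𝟙 A := by
  have h_retract : a ≫ b ≫ a = a := by
    rw [← Category.assoc, ← h_sandwich_l, Category.assoc, Category.assoc, h_action,
      ← comp_whiskerRight_assoc, h_special, id_whiskerRight, Category.id_comp]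
  calc
    b ≫ a = ((λ_ A).inv ≫ (bot ▷ A) ≫ a) ≫ b ≫ a := by rw [h_normal, Category.id_comp]
    _ = (λ_ A).inv ≫ (bot ▷ A) ≫ a := by rw [Category.assoc, Category.assoc, h_retract]
    _ = 𝟙 A := h_normal
end

section
/- Characterization of unbiased vectors in Rel: let X = Σ_{j ∈ J} G_j be the classical structure in Rel given by a disjoint union of abelian groups, with comultiplication relation Δ relating (j, g) to ((j, h), (j, k)) iff g = h + k. For a subset γ ⊆ X, viewed as a relation 1 → X, form E = {((j, h), (j, k)) : h + k ∈ γ_j} ⊆ X × X, the image of γ under Δ (where γ_j = {g : (j, g) ∈ γ}). Then E, viewed as a vector I → X ⊗ X, is strongly entangled — equivalently, the relational composite E ∘ E equals the identity relation on X — if and only if γ meets each block G_j in exactly one element, i.e. γ_j is a singleton for every j ∈ J. -/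
/-- **Statement 18.** Characterization of unbiased vectors in `Rel`: let
`X = Σ j, G j` be the classical structure in `Rel` given by a disjoint union of abelian
groups, `γ ⊆ X` a subset, and `E = {((j,h),(j,k)) : h + k ∈ γ_j}` the image of `γ` under
the comultiplication `Δ`. Then `E`, viewed as a vector `I ⟶ X ⊗ X`, is strongly entangled
— i.e. the relational composite `E ∘ E` is the identity relation on `X` — if and only if
`γ` meets each block `G j` in exactly one element. -/
theorem unbiased_iff_transversal
    {J : Type*} (G : J → Type*) [∀ j, AddCommGroup (G j)]
    (γ : Set (Σ j, G j))
    (E : (Σ j, G j) → (Σ j, G j) → Prop)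
    (hE : E = fun y z => ∃ (j : J) (h k : G j),
      y = ⟨j, h⟩ ∧ z = ⟨j, k⟩ ∧ (⟨j, h + k⟩ : Σ j, G j) ∈ γ) :
    ((fun a d => ∃ c, E a c ∧ E c d) = fun a d : (Σ j, G j) => a = d) ↔
      (∀ j : J, ∃! g : G j, (⟨j, g⟩ : Σ j, G j) ∈ γ) := by
  have E_mk (j : J) (h k : G j) : E ⟨j, h⟩ ⟨j, k⟩ ↔ (⟨j, h + k⟩ : Σ j, G j) ∈ γ := by
    subst hE
    constructor
    · rintro ⟨j', h', k', hy, hz, hm⟩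
      cases hy
      cases hz
      exact hm
    · exact fun hm => ⟨j, h, k, rfl, rfl, hm⟩
  have E_fst {j : J} {h : G j} {z : Σ j, G j} (hz : E ⟨j, h⟩ z) : ∃ k : G j, z = ⟨j, k⟩ := by
    subst hE
    obtain ⟨j', h', k', hy, rfl, -⟩ := hz
    cases hy
    exact ⟨k', rfl⟩
  constructor
  · intro H j
    have H' (a d : Σ j, G j) : (∃ c, E a c ∧ E c d) ↔ a = d :=
      iff_of_eq (congrFun (congrFun H a) d)
    obtain ⟨c, hc, -⟩ := (H' ⟨j, 0⟩ ⟨j, 0⟩).2 rfl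
    obtain ⟨k, rfl⟩ := E_fst hc
    rw [E_mk, zero_add] at hc
    refine ⟨k, hc, fun g hg => ?_⟩
    have hgk : (⟨j, g⟩ : Σ j, G j) = ⟨j, k⟩ :=
      (H' _ _).1 ⟨⟨j, 0⟩, (E_mk j g 0).2 (by simpa using hg), (E_mk j 0 k).2 (by simpa using hc)⟩
    exact eq_of_heq (Sigma.mk.inj hgk).2
  · intro H
    funext ⟨j, a⟩ d
    obtain ⟨g, hg, hu⟩ := H j
    refine propext ⟨?_, ?_⟩
    · rintro ⟨c, hac, hcd⟩
      obtain ⟨c, rfl⟩ := E_fst hac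
      obtain ⟨d, rfl⟩ := E_fst hcd
      have hsum : a + c = c + d := (hu _ ((E_mk _ _ _).1 hac)).trans (hu _ ((E_mk _ _ _).1 hcd)).symm
      rw [add_comm a c] at hsum
      rw [add_left_cancel hsum]
    · rintro rfl
      exact ⟨⟨j, g - a⟩, (E_mk _ _ _).2 (by simpa using hg), (E_mk _ _ _).2 (by simpa using hg)⟩
end

section
/- The row and column structures on a square are complementary classical structures in Rel: let n ≥ 1 and X = ℤ_n × ℤ_n. Equip X with the 'row' classical structure whose blocks are the rows {i} × ℤ_n with addition in the second coordinate (Δ_row relates (i, j) to ((i, k), (i, l)) iff j = k + l mod n), and the 'column' classical structure whose blocks are the columns ℤ_n × {j} with addition in the first coordinate. Then every basis vector of the column structure, i.e. every column γ_j = ℤ_n × {j}, is unbiased with respect to the row structure (its image under Δ_row is a strongly entangled vector), and symmetrically every row {i} × ℤ_n is unbiased with respect to the column structure; hence the two classical structures are complementary. -/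
/-- The image under the comultiplication of the "row" classical structure on
`ℤ_n × ℤ_n` (blocks the rows `{i} × ℤ_n`, addition in the second coordinate) of a subset
`γ`: it relates `y` to `z` iff they lie in a common row and their row-sum lies in `γ`. -/
def rowEnt (n : ℕ) (γ : Set (ZMod n × ZMod n)) :
    ZMod n × ZMod n → ZMod n × ZMod n → Prop :=
  fun y z => y.1 = z.1 ∧ (y.1, y.2 + z.2) ∈ γ

/-- The analogous relation for the "column" classical structure on `ℤ_n × ℤ_n`
(blocks the columns `ℤ_n × {j}`, addition in the first coordinate). -/
def colEnt (n : ℕ) (γ : Set (ZMod n × ZMod n)) :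
    ZMod n × ZMod n → ZMod n × ZMod n → Prop :=
  fun y z => y.2 = z.2 ∧ (y.1 + z.1, y.2) ∈ γ

/-- **Statement 19.** The row and column classical structures on `X = ℤ_n × ℤ_n` (`n ≥ 1`)
are complementary: every basis vector of the column structure (a column `ℤ_n × {j}`) is
unbiased with respect to the row structure — its image under the row comultiplication is a
strongly entangled vector, i.e. the relational composite equals the diagonal of `X` —
and symmetrically every row `{i} × ℤ_n` is unbiased with respect to the column
structure. -/
theorem rows_and_columns_complementary (n : ℕ) (hn : 1 ≤ n) :
    -- every column is unbiased with respect to the row structure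
    (∀ j : ZMod n,
      (fun a d => ∃ c, rowEnt n {p | p.2 = j} a c ∧ rowEnt n {p | p.2 = j} c d) =
        fun a d : ZMod n × ZMod n => a = d) ∧
    -- every row is unbiased with respect to the column structure
    (∀ i : ZMod n,
      (fun a d => ∃ c, colEnt n {p | p.1 = i} a c ∧ colEnt n {p | p.1 = i} c d) =
        fun a d : ZMod n × ZMod n => a = d) := by
  refine ⟨fun j => ?_, fun i => ?_⟩
  · ext ⟨a, b⟩ ⟨c, d⟩
    simp only [rowEnt, Set.mem_ofPred_eq, Prod.mk.injEq]
    constructor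
    · rintro ⟨⟨x, y⟩, ⟨hax, hby⟩, hxc, hyd⟩
      exact ⟨hax.trans hxc, add_right_cancel (hby.trans (hyd.symm.trans (add_comm y d)))⟩
    · rintro ⟨rfl, rfl⟩
      exact ⟨(a, j - b), ⟨rfl, add_sub_cancel b j⟩, rfl, sub_add_cancel j b⟩
  · ext ⟨a, b⟩ ⟨c, d⟩
    simp only [colEnt, Set.mem_ofPred_eq, Prod.mk.injEq]
    constructor
    · rintro ⟨⟨x, y⟩, ⟨hby, hax⟩, hyd, hxc⟩
      exact ⟨add_right_cancel (hax.trans (hxc.symm.trans (add_comm x c))), hby.trans hyd⟩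
    · rintro ⟨rfl, rfl⟩
      exact ⟨(i - a, b), ⟨rfl, add_sub_cancel a i⟩, rfl, sub_add_cancel i a⟩
end
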